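/- Let μ be a unit pure imaginary quaternion and let f ∈ 𝒮(ℝ²,ℍ) be a Schwartz function. Then for all (u,v) ∈ ℝ², L^{μ,μ}[∂²f/∂x²](u,v) = ∬_{ℝ²} ( μ a₁/b₁ − a₁²x²/b₁² + 2 a₁ x u / b₁² − u²/b₁² ) K_{A₁}^{μ}(x,u) f(x,y) K_{A₂}^{μ}(y,v) dx dy. -/

import Mathlib

noncomputable section
open MeasureTheory Real
open scoped ENNReal

abbrev ℍ : Type := Quaternion ℝ

/-- `μ` is a unit pure imaginary quaternion: `Re μ = 0` and `μ² = −1`. -/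
def UnitPureIm (μ : ℍ) : Prop := μ.re = 0 ∧ μ ^ 2 = -1

/-- membership in the slice `ℍ(μ) = {x + μ y : x, y ∈ ℝ}`. -/
def InSlice (μ : ℍ) (q : ℍ) : Prop := ∃ x y : ℝ, q = (x : ℍ) + y • μ

/-- `exp (t μ)` for a unit pure imaginary quaternion `μ`. -/
def qexp (μ : ℍ) (t : ℝ) : ℍ := (Real.cos t : ℍ) + Real.sin t • μ

/-- `(2πbμ)^(−1/2) := (2π|b|)^(−1/2) exp(−sgn(b) μ π/4)`. -/
def invSqrtFactor (μ : ℍ) (b : ℝ) : ℍ :=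
  (Real.sqrt (2 * π * |b|))⁻¹ • qexp μ (-(Real.sign b) * (π / 4))

/-- QLCT kernel `K_B^μ(x,u)` for `B = [[a,b],[c,d]]` (the entry `c` does not occur). -/
def K (μ : ℍ) (a b d : ℝ) (x u : ℝ) : ℍ :=
  invSqrtFactor μ b * qexp μ (a * x ^ 2 / (2 * b) - x * u / b + d * u ^ 2 / (2 * b))

/-- two-sided QLCT `L^{μ,ν}_{B₁,B₂}[f]`. -/
def QLCT (μ ν : ℍ) (a₁ b₁ d₁ a₂ b₂ d₂ : ℝ) (f : ℝ × ℝ → ℍ) : ℝ × ℝ → ℍ :=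
  fun w => ∫ p : ℝ × ℝ, K μ a₁ b₁ d₁ p.1 w.1 * f p * K ν a₂ b₂ d₂ p.2 w.2

/-- weight `W_B^μ(t,τ)` for `B = [[a,b],[c,d]]`. -/
def W (μ : ℍ) (a b : ℝ) (t τ : ℝ) : ℍ :=
  invSqrtFactor μ b * qexp μ (a * τ * (τ - t) / b)

/-- spatial convolution `f ⊛^{μ,ν}_{B₁,B₂} g`. -/
def sconv (μ ν : ℍ) (a₁ b₁ a₂ b₂ : ℝ) (f g : ℝ × ℝ → ℍ) : ℝ × ℝ → ℍ :=
  fun w => ∫ τ : ℝ × ℝ,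
    W μ a₁ b₁ w.1 τ.1 * f τ * g (w.1 - τ.1, w.2 - τ.2) * W ν a₂ b₂ w.2 τ.2

theorem Real.hasTemperateGrowth_cos : Real.cos.HasTemperateGrowth :=
  ⟨Real.contDiff_cos, fun n => ⟨0, 1, fun x => by
    simpa [norm_iteratedFDeriv_eq_norm_iteratedDeriv] using
      Real.abs_iteratedDeriv_cos_le_one n x⟩⟩

theorem Real.hasTemperateGrowth_sin : Real.sin.HasTemperateGrowth :=
  ⟨Real.contDiff_sin, fun n => ⟨0, 1, fun x => by
    simpa [norm_iteratedFDeriv_eq_norm_iteratedDeriv] using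
      Real.abs_iteratedDeriv_sin_le_one n x⟩⟩

theorem qexp_eq_smul (μ : ℍ) (t : ℝ) : qexp μ t = Real.cos t • (1 : ℍ) + Real.sin t • μ := by
  rw [qexp, ← Quaternion.coe_mul_eq_smul (Real.cos t), mul_one]

theorem commute_qexp (μ : ℍ) (t : ℝ) : Commute μ (qexp μ t) := by
  rw [qexp_eq_smul]
  exact ((Commute.one_right μ).smul_right _).add_right ((Commute.refl μ).smul_right _)

theorem commute_invSqrtFactor (μ : ℍ) (b : ℝ) : Commute μ (invSqrtFactor μ b) :=
  (commute_qexp μ _).smul_right _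

theorem hasTemperateGrowth_qexp (μ : ℍ) : (qexp μ).HasTemperateGrowth := by
  have h : qexp μ = fun t => Real.cos t • (1 : ℍ) + Real.sin t • μ := funext (qexp_eq_smul μ)
  rw [h]
  have hc := Real.hasTemperateGrowth_cos
  have hs := Real.hasTemperateGrowth_sin
  fun_prop

theorem hasDerivAt_qexp {μ : ℍ} (hμ : μ * μ = -1) (t : ℝ) :
    HasDerivAt (qexp μ) (μ * qexp μ t) t := by
  have h : qexp μ = fun t => Real.cos t • (1 : ℍ) + Real.sin t • μ := funext (qexp_eq_smul μ)
  rw [h]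
  refine (((Real.hasDerivAt_cos t).smul_const (1 : ℍ)).add
    ((Real.hasDerivAt_sin t).smul_const μ)).congr_deriv ?_
  simp only [mul_add, mul_smul_comm, mul_one, hμ, smul_neg, neg_smul]
  abel

theorem hasTemperateGrowth_K (μ : ℍ) (a b d u : ℝ) :
    (fun x => K μ a b d x u).HasTemperateGrowth := by
  have h : (fun x : ℝ =>
      a * x ^ 2 / (2 * b) - x * u / b + d * u ^ 2 / (2 * b)).HasTemperateGrowth := by
    simp only [div_eq_mul_inv]
    fun_prop
  exact (Function.HasTemperateGrowth.const (invSqrtFactor μ b)).mul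
    ((hasTemperateGrowth_qexp μ).comp h)

theorem hasDerivAt_K {μ : ℍ} (hμ : μ * μ = -1) (a b d u x : ℝ) :
    HasDerivAt (fun x => K μ a b d x u) (((a * x - u) / b) • (μ * K μ a b d x u)) x := by
  have h : HasDerivAt (fun x : ℝ => a * x ^ 2 / (2 * b) - x * u / b + d * u ^ 2 / (2 * b))
      ((a * x - u) / b) x := by
    refine ((((((hasDerivAt_id x).pow 2).const_mul a).div_const (2 * b)).sub
      (((hasDerivAt_id x).mul_const u).div_const b)).add_const
        (d * u ^ 2 / (2 * b))).congr_deriv ?_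
    simp only [id, div_eq_mul_inv, mul_inv]
    norm_num
    ring
  refine (((hasDerivAt_qexp hμ _).scomp x h).const_mul (invSqrtFactor μ b)).congr_deriv ?_
  rw [K, mul_smul_comm, ← mul_assoc, ← mul_assoc, (commute_invSqrtFactor μ b).eq]

/-- The derivative of `hasDerivAt_K`, differentiated once more. -/
theorem hasDerivAt_deriv_K {μ : ℍ} (hμ : μ * μ = -1) (a b d u x : ℝ) :
    HasDerivAt (fun x => ((a * x - u) / b) • (μ * K μ a b d x u))
      (((a / b) • μ - ((((a * x - u) / b) ^ 2 : ℝ) : ℍ)) * K μ a b d x u) x := by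
  have h : HasDerivAt (fun x : ℝ => (a * x - u) / b) (a / b) x := by
    simpa using (((hasDerivAt_id x).const_mul a).sub_const u).div_const b
  refine (h.smul ((hasDerivAt_K hμ a b d u x).const_mul μ)).congr_deriv ?_
  rw [mul_smul_comm, ← mul_assoc μ μ, hμ, sub_mul, smul_mul_assoc,
    Quaternion.coe_mul_eq_smul, smul_smul, neg_one_mul, smul_neg, sq]
  abel

open scoped SchwartzMap LineDeriv

theorem SchwartzMap.integrable_mul_mul (f : 𝓢(ℝ × ℝ, ℍ)) {G H : ℝ → ℍ}
    (hG : G.HasTemperateGrowth) (hH : H.HasTemperateGrowth) :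
    Integrable fun p : ℝ × ℝ => G p.1 * (f p * H p.2) := by
  have h₁ : (fun p : ℝ × ℝ => G p.1).HasTemperateGrowth :=
    hG.comp (ContinuousLinearMap.fst ℝ ℝ ℝ).hasTemperateGrowth
  have h₂ : (fun p : ℝ × ℝ => H p.2).HasTemperateGrowth :=
    hH.comp (ContinuousLinearMap.snd ℝ ℝ ℝ).hasTemperateGrowth
  exact (SchwartzMap.bilinLeftCLM (ContinuousLinearMap.mul ℝ ℍ).flip h₁
    (SchwartzMap.bilinLeftCLM (ContinuousLinearMap.mul ℝ ℍ) h₂ f)).integrable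

/-- Integration by parts in the first variable against a two-sided product weight. -/
theorem SchwartzMap.integral_mul_lineDeriv_fst_mul (f : 𝓢(ℝ × ℝ, ℍ)) {G G' H : ℝ → ℍ}
    (hG : G.HasTemperateGrowth) (hG' : G'.HasTemperateGrowth) (hH : H.HasTemperateGrowth)
    (hd : ∀ x, HasDerivAt G (G' x) x) :
    ∫ p : ℝ × ℝ, G p.1 * (∂_{((1, 0) : ℝ × ℝ)} f) p * H p.2 =
      -∫ p : ℝ × ℝ, G' p.1 * f p * H p.2 := by
  simp only [mul_assoc]
  refine integral_bilinear_hasLineDerivAt_right_eq_neg_left_of_integrable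
    (B := ContinuousLinearMap.mul ℝ ℍ) (f := fun p : ℝ × ℝ => G p.1) (f' := fun p => G' p.1)
    (g := fun p => f p * H p.2) (v := (1, 0))
    (f.integrable_mul_mul hG' hH) ((∂_{((1, 0) : ℝ × ℝ)} f).integrable_mul_mul hG hH)
    (f.integrable_mul_mul hG hH) (fun p _ => ?_) (fun p _ => ?_)
  · have h := (hd p.1).hasFDerivAt.comp p (hasFDerivAt_fst (𝕜 := ℝ) (E := ℝ) (F := ℝ))
    simpa using! h.hasLineDerivAt (1, 0)
  · have h : HasLineDerivAt ℝ f ((∂_{((1, 0) : ℝ × ℝ)} f) p) p (1, 0) :=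
      (f.differentiableAt (x := p)).hasFDerivAt.hasLineDerivAt _
    simpa [HasLineDerivAt] using! HasDerivAt.mul_const h (H p.2)

theorem qlct_second_partial_x
    (μ : ℍ) (hμ : UnitPureIm μ)
    (a₁ b₁ c₁ d₁ a₂ b₂ c₂ d₂ : ℝ)
    (hA₁ : a₁ * d₁ - b₁ * c₁ = 1) (hA₂ : a₂ * d₂ - b₂ * c₂ = 1)
    (hb₁ : b₁ ≠ 0) (hb₂ : b₂ ≠ 0)
    (f : SchwartzMap (ℝ × ℝ) ℍ) :
    ∀ u v : ℝ,
      QLCT μ μ a₁ b₁ d₁ a₂ b₂ d₂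
        (fun w => fderiv ℝ (fun q => fderiv ℝ (⇑f) q (1, 0)) w (1, 0)) (u, v) =
      ∫ w : ℝ × ℝ,
        ((a₁ / b₁) • μ -
          ((a₁ ^ 2 * w.1 ^ 2 / b₁ ^ 2 : ℝ) : ℍ) +
          ((2 * a₁ * w.1 * u / b₁ ^ 2 : ℝ) : ℍ) -
          ((u ^ 2 / b₁ ^ 2 : ℝ) : ℍ)) *
          K μ a₁ b₁ d₁ w.1 u * f w * K μ a₂ b₂ d₂ w.2 v := by
  intro u v
  have hμ' : μ * μ = -1 := by rw [← sq, hμ.2]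
  have hK := hasTemperateGrowth_K μ a₁ b₁ d₁ u
  have hH := hasTemperateGrowth_K μ a₂ b₂ d₂ v
  have hlin : (fun x : ℝ => (a₁ * x - u) / b₁).HasTemperateGrowth := by
    simp only [div_eq_mul_inv]
    fun_prop
  have hK' : (fun x => ((a₁ * x - u) / b₁) • (μ * K μ a₁ b₁ d₁ x u)).HasTemperateGrowth := by
    fun_prop
  have hK'' : (fun x => ((a₁ / b₁) • μ - ((((a₁ * x - u) / b₁) ^ 2 : ℝ) : ℍ)) *
      K μ a₁ b₁ d₁ x u).HasTemperateGrowth := by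
    simp only [sub_mul, Quaternion.coe_mul_eq_smul]
    fun_prop
  calc
    _ = ∫ p : ℝ × ℝ, K μ a₁ b₁ d₁ p.1 u *
        (∂_{((1, 0) : ℝ × ℝ)} (∂_{((1, 0) : ℝ × ℝ)} f)) p * K μ a₂ b₂ d₂ p.2 v := by
      have h (g : 𝓢(ℝ × ℝ, ℍ)) :
          (fun q => fderiv ℝ (⇑g) q (1, 0)) = ⇑(∂_{((1, 0) : ℝ × ℝ)} g : 𝓢(ℝ × ℝ, ℍ)) :=
        funext fun q => (SchwartzMap.lineDerivOp_apply_eq_fderiv _ g q).symm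
      rw [h, h, QLCT]
    _ = _ := by
      rw [SchwartzMap.integral_mul_lineDeriv_fst_mul _ hK hK' hH (hasDerivAt_K hμ' a₁ b₁ d₁ u),
        SchwartzMap.integral_mul_lineDeriv_fst_mul _ hK' hK'' hH
          (hasDerivAt_deriv_K hμ' a₁ b₁ d₁ u), neg_neg]
      refine integral_congr_ae (Filter.Eventually.of_forall fun p => ?_)
      have h : ((a₁ * p.1 - u) / b₁) ^ 2 = a₁ ^ 2 * p.1 ^ 2 / b₁ ^ 2 -
          2 * a₁ * p.1 * u / b₁ ^ 2 + u ^ 2 / b₁ ^ 2 := by ring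
      simp only [h, Quaternion.coe_add, Quaternion.coe_sub]
      congr 3
      abel
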